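/- arXiv:1404.3801 — 6 statements merged into one kernel-verified Lean document; each statement's English description precedes it below -/
import Mathlib

section
/- Let R be a NAND-free k-ary Boolean relation and let F = f_1 … f_q be a flip sequence valid at s ∈ R. If for some i ∈ {1,…,q−1} the flip f_i = x⁻ is a negative flip and f_{i+1} = y⁺ is a positive flip with x ≠ y, then the sequence F' = f_1 … f_{i−1} f_{i+1} f_i … f_q obtained by swapping f_i and f_{i+1} is also valid at s and is equivalent to F. -/
def IsRestriction {k k' : ℕ} (R : Set (Fin k → Bool)) (R' : Set (Fin k' → Bool)) : Prop :=
  k' ≤ k ∧ ∃ X : Fin k → (Fin k' ⊕ Bool),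
    ∀ r : Fin k' → Bool, r ∈ R' ↔ (fun i => Sum.elim r id (X i)) ∈ R

/-- The NAND relation `{01, 10, 00}`. -/
def nandRel : Set (Fin 2 → Bool) := {r | ¬(r 0 = true ∧ r 1 = true)}

/-- `R` is NAND-free if no restriction of `R` equals the NAND relation. -/
def NANDFree {k : ℕ} (R : Set (Fin k → Bool)) : Prop := ¬ IsRestriction R nandRel

/-- A flip is a variable together with the value it flips *to*:
`(i, true)` is the positive flip `xᵢ⁺` (0→1), `(i, false)` the negative flip `xᵢ⁻` (1→0). -/
abbrev Flip (α : Type) := α × Bool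

/-- Apply a flip to an assignment. -/
def applyFlip {α : Type} [DecidableEq α] (a : α → Bool) (f : Flip α) : α → Bool :=
  Function.update a f.1 f.2

/-- Apply a flip sequence (left to right) to an assignment; `applySeq s F` is `F(s)`. -/
def applySeq {α : Type} [DecidableEq α] (s : α → Bool) (F : List (Flip α)) : α → Bool :=
  F.foldl applyFlip s

/-- `ValidSeq R s F`: the flip sequence `F` is valid at `s` with respect to `R`, i.e.
each flip in turn is applicable and every intermediate assignment (including `s` and
the final one) lies in `R`. -/
def ValidSeq {α : Type} [DecidableEq α] (R : Set (α → Bool)) :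
    (α → Bool) → List (Flip α) → Prop
  | s, [] => s ∈ R
  | s, f :: F => s ∈ R ∧ s f.1 = !f.2 ∧ ValidSeq R (applyFlip s f) F


theorem NANDFree.update_mem {k : ℕ} {R : Set (Fin k → Bool)} (hR : NANDFree R)
    {a : Fin k → Bool} {x y : Fin k} (hxy : x ≠ y) (hx : a x = true) (hy : a y = false)
    (h10 : a ∈ R) (h00 : Function.update a x false ∈ R)
    (h01 : Function.update (Function.update a x false) y true ∈ R) :
    Function.update a y true ∈ R := by
  by_contra h11
  refine hR ⟨?_, fun i => if i = x then .inl 0 else if i = y then .inl 1 else .inr (a i), ?_⟩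
  · have := x.isLt
    have := y.isLt
    have := Fin.val_ne_of_ne hxy
    omega
  intro r
  have key : (fun i => Sum.elim r id
      (if i = x then .inl 0 else if i = y then .inl 1 else .inr (a i))) =
      Function.update (Function.update a x (r 0)) y (r 1) := by
    funext i
    simp only [Function.update_apply]
    split_ifs <;> simp_all
  have hx' : Function.update a x true = a := Function.update_eq_self_iff.mpr hx.symm
  have hy' : Function.update a y false = a := Function.update_eq_self_iff.mpr hy.symm
  have hy'' : Function.update (Function.update a x false) y false = Function.update a x false := by
    rw [Function.update_comm hxy, hy']
  simp only [key, nandRel, Set.mem_ofPred_eq]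
  cases h0 : r 0 <;> cases h1 : r 1 <;> simp [*]

theorem ValidSeq.start_mem {α : Type} [DecidableEq α] {R : Set (α → Bool)} {s : α → Bool}
    {F : List (Flip α)} (h : ValidSeq R s F) : s ∈ R := by
  cases F with
  | nil => exact h
  | cons f F => exact h.1

theorem validSeq_append_iff {α : Type} [DecidableEq α] {R : Set (α → Bool)} {s : α → Bool}
    {A B : List (Flip α)} :
    ValidSeq R s (A ++ B) ↔ ValidSeq R s A ∧ ValidSeq R (applySeq s A) B := by
  induction A generalizing s with
  | nil => exact ⟨fun h => ⟨h.start_mem, h⟩, fun h => h.2⟩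
  | cons f A ih => simp [ValidSeq, applySeq, ih, and_assoc]

theorem applyFlip_comm {α : Type} [DecidableEq α] (a : α → Bool) {f g : Flip α}
    (h : f.1 ≠ g.1) : applyFlip (applyFlip a f) g = applyFlip (applyFlip a g) f :=
  Function.update_comm h _ _ _

/-- Lemma 1 (swap lemma): for `R` a NAND-free relation and a flip sequence valid at `s ∈ R`
containing a negative flip `x⁻` immediately followed by a positive flip `y⁺` with `x ≠ y`,
swapping the two flips yields a sequence that is also valid at `s` and equivalent to the
original one. -/
theorem swap_neg_pos {k : ℕ} (R : Set (Fin k → Bool)) (hR : NANDFree R)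
    (s : Fin k → Bool) (hs : s ∈ R) (x y : Fin k) (hxy : x ≠ y)
    (A B : List (Flip (Fin k)))
    (hvalid : ValidSeq R s (A ++ (x, false) :: (y, true) :: B)) :
    ValidSeq R s (A ++ (y, true) :: (x, false) :: B) ∧
      applySeq s (A ++ (y, true) :: (x, false) :: B) =
        applySeq s (A ++ (x, false) :: (y, true) :: B) := by
  have hcomm (a : Fin k → Bool) : applyFlip (applyFlip a (x, false)) (y, true) =
      applyFlip (applyFlip a (y, true)) (x, false) := applyFlip_comm a hxy
  refine ⟨?_, by simp [applySeq, hcomm]⟩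
  rw [validSeq_append_iff] at hvalid ⊢
  obtain ⟨hA, ha, hx, ha', hy, hB⟩ := hvalid
  have hy' : applySeq s A y = false := by simpa [applyFlip, hxy.symm] using hy
  refine ⟨hA, ha, hy', ?_, ?_, hcomm _ ▸ hB⟩
  · exact hR.update_mem hxy hx hy' ha ha' hB.start_mem
  · simpa [applyFlip, hxy] using hx
end

section
/- Let R be a NAND-free and dual-Horn-free k-ary Boolean relation and let s, t_1, t_2 ∈ R be three distinct assignments such that the flip sequence x⁺ z⁺ is valid at s and transforms s to t_1, the flip sequence y⁺ z⁺ is valid at s and transforms s to t_2, and x ≠ y. Then the sequence z⁺ x⁺ is also valid at s and transforms s to t_1, and the sequence z⁺ y⁺ is also valid at s and transforms s to t_2. -/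
/-- The OR relation `{01, 10, 11}`. -/
def orRel : Set (Fin 2 → Bool) := {r | r 0 = true ∨ r 1 = true}

/-- The dual-Horn-clause relation `{0,1}^3 \ {100}`. -/
def dualHornRel : Set (Fin 3 → Bool) := {r | ¬(r 0 = true ∧ r 1 = false ∧ r 2 = false)}

/-- `R` is OR-free if no restriction of `R` equals the OR relation `{01,10,11}`. -/
def ORFree {k : ℕ} (R : Set (Fin k → Bool)) : Prop := ¬ IsRestriction R orRel

/-- `R` is dual-Horn-free if no restriction of `R` equals `{0,1}^3 \ {100}`. -/
def DualHornFree {k : ℕ} (R : Set (Fin k → Bool)) : Prop := ¬ IsRestriction R dualHornRel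

/-- The assignment that agrees with `s` except that `x`, `y`, `z` receive `a`, `b`, `c`. -/
def assignThree {k : ℕ} (s : Fin k → Bool) (x y z : Fin k) (a b c : Bool) : Fin k → Bool :=
  fun i => if i = z then c else if i = x then a else if i = y then b else s i

/-- Substituting variables and constants for three coordinates, and constants for the others,
produces a restriction. -/
theorem IsRestriction.of_assignThree {k k' : ℕ} {R : Set (Fin k → Bool)}
    {R' : Set (Fin k' → Bool)} (hk : k' ≤ k) (s : Fin k → Bool) (x y z : Fin k)
    (u v w : Fin k' ⊕ Bool)
    (h : ∀ r : Fin k' → Bool, r ∈ R' ↔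
      assignThree s x y z (Sum.elim r id u) (Sum.elim r id v) (Sum.elim r id w) ∈ R) :
    IsRestriction R R' := by
  refine ⟨hk, fun i => if i = z then w else if i = x then u else if i = y then v
    else Sum.inr (s i), fun r => ?_⟩
  rw [h r]
  refine iff_of_eq (congrArg (· ∈ R) (funext fun i => ?_))
  simp only [assignThree]
  split_ifs <;> rfl

theorem three_le_of_pairwise_ne {k : ℕ} {x y z : Fin k} (hxy : x ≠ y) (hxz : x ≠ z)
    (hyz : y ≠ z) : 3 ≤ k := by
  have h := Finset.card_le_univ ({x, y, z} : Finset (Fin k))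
  rwa [Finset.card_eq_three.mpr ⟨x, y, z, hxy, hxz, hyz, rfl⟩, Fintype.card_fin] at h

/-- In a NAND-free and dual-Horn-free relation, a face of a 3-cube that contains
`000, 100, 010, 101, 011` also contains `001`. -/
theorem assignThree_mem_of_nandFree_of_dualHornFree {k : ℕ} {R : Set (Fin k → Bool)}
    (hnand : NANDFree R) (hdh : DualHornFree R) (s : Fin k → Bool) {x y z : Fin k} (hk : 3 ≤ k)
    (h000 : assignThree s x y z false false false ∈ R)
    (h100 : assignThree s x y z true false false ∈ R)
    (h010 : assignThree s x y z false true false ∈ R)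
    (h101 : assignThree s x y z true false true ∈ R)
    (h011 : assignThree s x y z false true true ∈ R) :
    assignThree s x y z false false true ∈ R := by
  by_contra h001
  have h110 : assignThree s x y z true true false ∈ R := by
    by_contra h110
    refine hnand (.of_assignThree (by omega) s x y z (.inl 0) (.inl 1) (.inr false) fun r => ?_)
    cases h0 : r 0 <;> cases h1 : r 1 <;> simp [nandRel, *]
  have h111 : assignThree s x y z true true true ∉ R := by
    intro h111
    refine hdh (.of_assignThree hk s x y z (.inl 1) (.inl 2) (.inl 0) fun r => ?_)
    cases h0 : r 0 <;> cases h1 : r 1 <;> cases h2 : r 2 <;> simp [dualHornRel, *]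
  refine hnand (.of_assignThree (by omega) s x y z (.inr true) (.inl 0) (.inl 1) fun r => ?_)
  cases h0 : r 0 <;> cases h1 : r 1 <;> simp [nandRel, *]


/-- Lemma 5: for `R` NAND-free and dual-Horn-free and distinct `s, t₁, t₂ ∈ R` with
`x⁺ z⁺` transforming `s` to `t₁`, `y⁺ z⁺` transforming `s` to `t₂`, and `x ≠ y`, the
sequence `z⁺ x⁺` also transforms `s` to `t₁` and `z⁺ y⁺` also transforms `s` to `t₂`. -/
theorem swap_two_pos_flips {k : ℕ} (R : Set (Fin k → Bool))
    (hnand : NANDFree R) (hdh : DualHornFree R)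
    (s t1 t2 : Fin k → Bool) (hs : s ∈ R) (ht1 : t1 ∈ R) (ht2 : t2 ∈ R)
    (hst1 : s ≠ t1) (hst2 : s ≠ t2) (ht12 : t1 ≠ t2)
    (x y z : Fin k) (hxy : x ≠ y)
    (h1 : ValidSeq R s [(x, true), (z, true)]) (h1t : applySeq s [(x, true), (z, true)] = t1)
    (h2 : ValidSeq R s [(y, true), (z, true)]) (h2t : applySeq s [(y, true), (z, true)] = t2) :
    (ValidSeq R s [(z, true), (x, true)] ∧ applySeq s [(z, true), (x, true)] = t1) ∧
    (ValidSeq R s [(z, true), (y, true)] ∧ applySeq s [(z, true), (y, true)] = t2) := by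
  subst h1t h2t
  simp only [ValidSeq, applySeq, applyFlip, List.foldl_cons, List.foldl_nil,
    Bool.not_true] at h1 h2 ht1 ht2 ⊢
  obtain ⟨-, hsx, hx, hxz', -⟩ := h1
  obtain ⟨-, hsy, hy, hyz', -⟩ := h2
  have hxz : x ≠ z := by rintro rfl; simp at hxz'
  have hyz : y ≠ z := by rintro rfl; simp at hyz'
  have hsz : s z = false := by rwa [Function.update_of_ne hxz.symm] at hxz'
  have hz : Function.update s z true ∈ R := by
    have h := assignThree_mem_of_nandFree_of_dualHornFree hnand hdh s (x := x) (y := y) (z := z)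
      (three_le_of_pairwise_ne hxy hxz hyz)
      (by convert hs using 1; funext i; grind [assignThree])
      (by convert hx using 1; funext i; grind [assignThree, Function.update_apply])
      (by convert hy using 1; funext i; grind [assignThree, Function.update_apply])
      (by convert ht1 using 1; funext i; grind [assignThree, Function.update_apply])
      (by convert ht2 using 1; funext i; grind [assignThree, Function.update_apply])
    convert h using 1
    funext i
    grind [assignThree, Function.update_apply]
  rw [Function.update_comm hxz.symm, Function.update_comm hyz.symm,
    Function.update_of_ne hxz, Function.update_of_ne hyz]
  exact ⟨⟨⟨hs, hsz, hz, hsx, ht1⟩, rfl⟩, ⟨hs, hsz, hz, hsy, ht2⟩, rfl⟩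
end

section
/- Let R be a NAND-free and dual-Horn-free k-ary Boolean relation and let s, t ∈ R be two assignments such that the sequence x⁺ y⁺ is valid at s and the flip y⁺ is valid at t. Furthermore, let F be a positive flip sequence valid at s such that F(s) = t and x⁺ ∉ C(F). Then the sequence y⁺ x⁺ is also valid at s. -/
/-- Substitute `r` for the variables of a restriction map `X`. -/
def substRestr {k k' : ℕ} (X : Fin k → Fin k' ⊕ Bool) (r : Fin k' → Bool) : Fin k → Bool :=
  fun i => Sum.elim r id (X i)

theorem NANDFree.substRestr_mem {k : ℕ} {R : Set (Fin k → Bool)} (hR : NANDFree R) (hk : 2 ≤ k)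
    (X : Fin k → Fin 2 ⊕ Bool) (h00 : substRestr X ![false, false] ∈ R)
    (h01 : substRestr X ![false, true] ∈ R) (h10 : substRestr X ![true, false] ∈ R) :
    substRestr X ![true, true] ∈ R := by
  by_contra h11
  refine hR ⟨hk, X, fun r => ?_⟩
  change _ ↔ substRestr X r ∈ R
  obtain ⟨a, b, rfl⟩ : ∃ a b, r = ![a, b] := ⟨r 0, r 1, by ext i; fin_cases i <;> rfl⟩
  cases a <;> cases b <;> simp [nandRel, *]

theorem DualHornFree.substRestr_mem {k : ℕ} {R : Set (Fin k → Bool)} (hR : DualHornFree R)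
    (hk : 3 ≤ k) (X : Fin k → Fin 3 ⊕ Bool)
    (h : ∀ a b c, (a, b, c) ≠ (true, false, false) → substRestr X ![a, b, c] ∈ R) :
    substRestr X ![true, false, false] ∈ R := by
  by_contra h100
  refine hR ⟨hk, X, fun r => ?_⟩
  change _ ↔ substRestr X r ∈ R
  obtain ⟨a, b, c, rfl⟩ : ∃ a b c, r = ![a, b, c] :=
    ⟨r 0, r 1, r 2, by ext i; fin_cases i <;> rfl⟩
  have habc := h a b c
  cases a <;> cases b <;> cases c <;> simp_all [dualHornRel]

theorem applySeq_apply_of_pos {α : Type} [DecidableEq α] {F : List (Flip α)}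
    (hF : ∀ f ∈ F, f.2 = true) (s : α → Bool) (i : α) :
    applySeq s F i = true ↔ s i = true ∨ (i, true) ∈ F := by
  induction F generalizing s with
  | nil => simp [applySeq]
  | cons f F ih =>
    obtain ⟨j, b⟩ := f
    obtain rfl : b = true := hF _ List.mem_cons_self
    change applySeq (applyFlip s (j, true)) F i = true ↔ _
    rw [ih fun f hf => hF f (List.mem_cons_of_mem _ hf)]
    by_cases hij : i = j <;> simp [applyFlip, hij]

/-- The assignment with value `a` at `y`, value `b` at `x`, and elsewhere equal to `t` or `s`
depending on `c`. -/
def mixAssign {k : ℕ} (s t : Fin k → Bool) (x y : Fin k) (a b c : Bool) : Fin k → Bool :=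
  fun i => if i = y then a else if i = x then b else if c then t i else s i

/-- Up to identifications of variables, `mixAssign` is a substitution. -/
theorem exists_substRestr_eq_mixAssign {k k' : ℕ} {s t : Fin k → Bool} (x y : Fin k)
    (hst : ∀ i, s i = true → t i = true) (u v : Fin k' ⊕ Bool) (w : Fin k') :
    ∃ X : Fin k → Fin k' ⊕ Bool, ∀ r, substRestr X r =
      mixAssign s t x y (Sum.elim r id u) (Sum.elim r id v) (r w) := by
  refine ⟨fun i => if i = y then u else if i = x then v else
    if s i = t i then Sum.inr (s i) else Sum.inl w, fun r => ?_⟩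
  ext i
  have hi := hst i
  unfold substRestr mixAssign
  split_ifs <;> cases hs : s i <;> cases ht : t i <;> simp_all

/-- A positive flip `y⁺` may be performed first, if it is possible after `x⁺` and at some
assignment `t ≥ s` that agrees with `s` at `x` and `y`. -/
theorem update_mem_of_le {k : ℕ} {R : Set (Fin k → Bool)}
    (hnand : NANDFree R) (hdh : DualHornFree R) {s t : Fin k → Bool} {x y : Fin k} (hxy : x ≠ y)
    (hst : ∀ i, s i = true → t i = true) (htx : t x = false) (hty : t y = false)
    (hs : s ∈ R) (ht : t ∈ R) (hsx : Function.update s x true ∈ R)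
    (hsxy : Function.update (Function.update s x true) y true ∈ R)
    (hty' : Function.update t y true ∈ R) : Function.update s y true ∈ R := by
  by_cases heq : s = t
  · rwa [heq]
  obtain ⟨z, hz⟩ := Function.ne_iff.mp heq
  have hsx0 : s x = false := by simpa [htx] using hst x
  have hsy0 : s y = false := by simpa [hty] using hst y
  have hk : 3 ≤ k := by
    have hzx : z ≠ x := by rintro rfl; simp_all
    have hzy : z ≠ y := by rintro rfl; simp_all
    have := x.isLt; have := y.isLt; have := z.isLt
    simp only [ne_eq, Fin.ext_iff] at hzx hzy hxy
    omega
  have h000 : mixAssign s t x y false false false ∈ R := by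
    convert hs using 1; ext i; grind [mixAssign]
  have h001 : mixAssign s t x y false false true ∈ R := by
    convert ht using 1; ext i; grind [mixAssign]
  have h010 : mixAssign s t x y false true false ∈ R := by
    convert hsx using 1; ext i; grind [mixAssign]
  have h110 : mixAssign s t x y true true false ∈ R := by
    convert hsxy using 1; ext i; grind [mixAssign]
  have h101 : mixAssign s t x y true false true ∈ R := by
    convert hty' using 1; ext i; grind [mixAssign]
  have h011 : mixAssign s t x y false true true ∈ R := by
    obtain ⟨X, hX⟩ := exists_substRestr_eq_mixAssign (k' := 2) x y hst (.inr false) (.inl 0) 1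
    simpa [hX] using hnand.substRestr_mem (by omega) X (by simpa [hX]) (by simpa [hX])
      (by simpa [hX])
  have h111 : mixAssign s t x y true true true ∈ R := by
    obtain ⟨X, hX⟩ := exists_substRestr_eq_mixAssign (k' := 2) x y hst (.inl 0) (.inl 0) 1
    simpa [hX] using hnand.substRestr_mem (by omega) X (by simpa [hX]) (by simpa [hX])
      (by simpa [hX])
  obtain ⟨X, hX⟩ := exists_substRestr_eq_mixAssign (k' := 3) x y hst (.inl 0) (.inl 1) 2
  have h100 := hdh.substRestr_mem hk X (by
    intro a b c habc
    cases a <;> cases b <;> cases c <;> simp_all)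
  have h100' : mixAssign s t x y true false false ∈ R := by simpa [hX] using h100
  convert h100' using 1; ext i; grind [mixAssign]

/-- Lemma 6: for `R` NAND-free and dual-Horn-free, `s, t ∈ R` with `x⁺ y⁺` valid at `s`,
`y⁺` valid at `t`, and `F` a positive flip sequence transforming `s` to `t` with
`x⁺ ∉ C(F)`, the sequence `y⁺ x⁺` is also valid at `s`. -/
theorem swap_pos_pair_valid {k : ℕ} (R : Set (Fin k → Bool))
    (hnand : NANDFree R) (hdh : DualHornFree R)
    (s t : Fin k → Bool) (hs : s ∈ R) (ht : t ∈ R) (x y : Fin k)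
    (hxy : ValidSeq R s [(x, true), (y, true)])
    (hyt : ValidSeq R t [(y, true)])
    (F : List (Flip (Fin k))) (hpos : ∀ f ∈ F, f.2 = true)
    (hF : ValidSeq R s F) (hFt : applySeq s F = t)
    (hxF : (x, true) ∉ F) :
    ValidSeq R s [(y, true), (x, true)] := by
  simp only [ValidSeq, applyFlip, Bool.not_true] at hxy hyt ⊢
  obtain ⟨-, hsx, hxR, hxy0, hxyR⟩ := hxy
  obtain ⟨-, hty, htyR⟩ := hyt
  have hne : x ≠ y := by rintro rfl; simp at hxy0
  have happ := applySeq_apply_of_pos hpos s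
  rw [hFt] at happ
  have htx : t x = false := by
    rw [← Bool.not_eq_true, happ]
    simp [hsx, hxF]
  have hsy : s y = false := by simpa [hne.symm] using hxy0
  refine ⟨hs, hsy, update_mem_of_le hnand hdh hne (fun i hi => (happ i).2 (.inl hi)) htx hty hs ht
    hxR hxyR htyR, by simpa [hne] using hsx, ?_⟩
  rwa [Function.update_comm hne.symm]
end

section
/- Let R be a NAND-free and dual-Horn-free k-ary Boolean relation. If F_1 · x⁺ · y⁺ and F_2 · y⁺ are both valid positive flip sequences at s ∈ R such that x⁺ ∉ C(F_2), then F_1 · y⁺ · x⁺ is also valid at s. -/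
theorem validSeq_append {α : Type} [DecidableEq α] {R : Set (α → Bool)} {s : α → Bool}
    {F G : List (Flip α)} :
    ValidSeq R s (F ++ G) ↔ ValidSeq R s F ∧ ValidSeq R (applySeq s F) G := by
  induction F generalizing s with
  | nil =>
    refine ⟨fun h => ⟨?_, h⟩, fun h => h.2⟩
    cases G with
    | nil => exact h
    | cons g G => exact h.1
  | cons f F ih => simp only [List.cons_append, ValidSeq, ih, applySeq, List.foldl_cons]; tauto

theorem le_applySeq {α : Type} [DecidableEq α] {F : List (Flip α)}
    (hF : ∀ f ∈ F, f.2 = true) (s : α → Bool) : s ≤ applySeq s F := by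
  induction F generalizing s with
  | nil => exact le_rfl
  | cons f F ih =>
    refine le_trans ?_ (ih (fun g hg => hF g (by simp [hg])) (applyFlip s f))
    have hf : f.2 = true := hF f (by simp)
    intro i
    by_cases hi : i = f.1
    · subst hi; simp [applyFlip, hf, Bool.le_true]
    · simp [applyFlip, hi]

theorem applySeq_apply_of_notMem {α : Type} [DecidableEq α] {F : List (Flip α)} {i : α}
    (h : ∀ f ∈ F, f.1 ≠ i) (s : α → Bool) : applySeq s F i = s i := by
  induction F generalizing s with
  | nil => rfl
  | cons f F ih =>
    have hf : f.1 ≠ i := h f (by simp)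
    refine (ih (fun g hg => h g (by simp [hg])) (applyFlip s f)).trans ?_
    simp [applyFlip, hf.symm]

/-- In a NAND-free relation, two members whose meet is a member have their join as a member. -/
theorem NANDFree.sup_mem {k : ℕ} {R : Set (Fin k → Bool)} (hR : NANDFree R)
    {a b : Fin k → Bool} (ha : a ∈ R) (hb : b ∈ R) (hab : a ⊓ b ∈ R) : a ⊔ b ∈ R := by
  by_contra hsup
  have hnab : ¬ a ≤ b := fun h => hsup (by rwa [sup_eq_right.2 h])
  have hnba : ¬ b ≤ a := fun h => hsup (by rwa [sup_eq_left.2 h])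
  obtain ⟨i, hi⟩ := not_forall.1 hnab
  obtain ⟨j, hj⟩ := not_forall.1 hnba
  have hij : i ≠ j := by
    rintro rfl
    exact (le_total (a i) (b i)).elim hi hj
  have hk : 2 ≤ k := by
    have := Finset.card_le_univ ({i, j} : Finset (Fin k))
    rwa [Finset.card_pair hij, Fintype.card_fin] at this
  refine hR ⟨hk, fun i => match a i, b i with
    | true, true => .inr true
    | false, false => .inr false
    | true, false => .inl 0
    | false, true => .inl 1, fun r => ?_⟩
  have key : ∀ c : Fin k → Bool, (∀ i, c i = match a i, b i with
      | true, true => true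
      | false, false => false
      | true, false => r 0
      | false, true => r 1) → ((r ∈ nandRel ↔ c ∈ R) → (r ∈ nandRel ↔
        (fun i => Sum.elim r id (match a i, b i with
          | true, true => (.inr true : Fin 2 ⊕ Bool)
          | false, false => .inr false
          | true, false => .inl 0
          | false, true => .inl 1)) ∈ R)) := by
    intro c hc h
    rw [h]
    refine iff_of_eq (congrArg (· ∈ R) (funext fun i => ?_))
    rw [hc i]
    cases a i <;> cases b i <;> rfl
  cases h0 : r 0 <;> cases h1 : r 1
  · refine key (a ⊓ b) (fun i => ?_) (by simp [nandRel, h0, hab])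
    simp only [Pi.inf_apply, h0, h1]; cases a i <;> cases b i <;> rfl
  · refine key b (fun i => ?_) (by simp [nandRel, h0, hb])
    simp only [h0, h1]; cases a i <;> cases b i <;> rfl
  · refine key a (fun i => ?_) (by simp [nandRel, h1, ha])
    simp only [h0, h1]; cases a i <;> cases b i <;> rfl
  · refine key (a ⊔ b) (fun i => ?_) (by simp [nandRel, h0, h1, hsup])
    simp only [Pi.sup_apply, h0, h1]; cases a i <;> cases b i <;> rfl

/-- The endpoint of a valid positive flip sequence at `s` can be joined with any member
above `s` of a NAND-free relation. -/
theorem NANDFree.applySeq_sup_mem {k : ℕ} {R : Set (Fin k → Bool)} (hR : NANDFree R)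
    {F : List (Flip (Fin k))} (hF : ∀ f ∈ F, f.2 = true) {s b : Fin k → Bool}
    (hv : ValidSeq R s F) (hb : b ∈ R) (hsb : s ≤ b) : applySeq s F ⊔ b ∈ R := by
  induction F generalizing s b with
  | nil =>
    change s ⊔ b ∈ R
    rwa [sup_eq_right.2 hsb]
  | cons f F ih =>
    obtain ⟨hs, hf0, hv⟩ := hv
    have hf : f.2 = true := hF f (by simp)
    have hF' : ∀ g ∈ F, g.2 = true := fun g hg => hF g (by simp [hg])
    have hle := le_applySeq hF' (applyFlip s f)
    have hmem : applyFlip s f ∈ R := by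
      cases F with
      | nil => exact hv
      | cons g G => exact hv.1
    have hsup : applyFlip s f ⊔ b ∈ R := by
      by_cases hbf : b f.1 = true
      · have : applyFlip s f ≤ b := by
          intro i
          by_cases hi : i = f.1
          · subst hi; simp [hbf, Bool.le_true]
          · simpa [applyFlip, hi] using hsb i
        rwa [sup_eq_right.2 this]
      · refine hR.sup_mem hmem hb ?_
        have : applyFlip s f ⊓ b = s := by
          funext i
          by_cases hi : i = f.1
          · subst hi; simp_all [applyFlip]
          · simpa [applyFlip, hi, Bool.le_iff_imp] using hsb i
        rwa [this]
    have := ih hF' hv hsup le_sup_left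
    rwa [← sup_assoc, sup_eq_left.2 hle] at this

/-- In a dual-Horn-free relation, `y` can be flipped at `a` provided that all other ways of
raising `a` by some of `x`, `y` and `b` stay in the relation. -/
theorem DualHornFree.update_mem {k : ℕ} {R : Set (Fin k → Bool)} (hR : DualHornFree R)
    {a b : Fin k → Bool} {x y : Fin k} (hxy : x ≠ y)
    (hax : a x = false) (hay : a y = false) (hbx : b x = false) (hby : b y = false)
    (ha : a ∈ R) (hx : Function.update a x true ∈ R)
    (hyx : Function.update (Function.update a x true) y true ∈ R)
    (hb : a ⊔ b ∈ R) (hbx' : Function.update (a ⊔ b) x true ∈ R)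
    (hby' : Function.update (a ⊔ b) y true ∈ R)
    (hbyx : Function.update (Function.update (a ⊔ b) x true) y true ∈ R) :
    Function.update a y true ∈ R := by
  by_contra hy
  have hnba : ¬ b ≤ a := fun h => hy (by rwa [sup_eq_left.2 h] at hby')
  obtain ⟨z, hz⟩ := not_forall.1 hnba
  have hzx : x ≠ z := by rintro rfl; simp [hbx] at hz
  have hzy : y ≠ z := by rintro rfl; simp [hby] at hz
  have hk : 3 ≤ k := by
    have := Finset.card_le_univ ({x, y, z} : Finset (Fin k))
    rwa [Finset.card_eq_three.2 ⟨x, y, z, hxy, hzx, hzy, rfl⟩, Fintype.card_fin] at this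
  refine hR ⟨hk, fun i => if i = y then .inl 0 else if i = x then .inl 1 else
    if a i = true then .inr true else if b i = true then .inl 2 else .inr false, fun r => ?_⟩
  have key : ∀ c : Fin k → Bool, c y = r 0 → c x = r 1 →
      (∀ i, i ≠ y → i ≠ x → c i = (a i || (b i && r 2))) → (r ∈ dualHornRel ↔ c ∈ R) →
      (r ∈ dualHornRel ↔ (fun i => Sum.elim r id (if i = y then (.inl 0 : Fin 3 ⊕ Bool)
        else if i = x then .inl 1 else
        if a i = true then .inr true else if b i = true then .inl 2 else .inr false)) ∈ R) := by
    intro c hcy hcx hc h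
    rw [h]
    refine iff_of_eq (congrArg (· ∈ R) (funext fun i => ?_))
    by_cases hiy : i = y
    · simp [hiy, hcy]
    by_cases hix : i = x
    · simp [hix, hxy, hcx]
    rw [hc i hiy hix]
    cases a i <;> cases b i <;> simp [hiy, hix]
  cases h0 : r 0 <;> cases h1 : r 1 <;> cases h2 : r 2
  · exact key a
      (by simp [hay, h0]) (by simp [hax, h1])
      (fun i hiy hix => by simp [h2]) (by simp [dualHornRel, h0, h1, h2, ha])
  · exact key (a ⊔ b)
      (by simp [hay, hby, h0]) (by simp [hax, hbx, h1])
      (fun i hiy hix => by simp [h2]) (by simp [dualHornRel, h0, h1, h2, hb])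
  · exact key (Function.update a x true)
      (by simp [hxy.symm, hay, h0]) (by simp [h1])
      (fun i hiy hix => by simp [hix, h2]) (by simp [dualHornRel, h0, h1, h2, hx])
  · exact key (Function.update (a ⊔ b) x true)
      (by simp [hxy.symm, hay, hby, h0]) (by simp [h1])
      (fun i hiy hix => by simp [hix, h2]) (by simp [dualHornRel, h0, h1, h2, hbx'])
  · exact key (Function.update a y true)
      (by simp [h0]) (by simp [hxy, hax, h1])
      (fun i hiy hix => by simp [hiy, h2]) (by simp [dualHornRel, h0, h1, h2, hy])
  · exact key (Function.update (a ⊔ b) y true)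
      (by simp [h0]) (by simp [hxy, hax, hbx, h1])
      (fun i hiy hix => by simp [hiy, h2]) (by simp [dualHornRel, h0, h1, h2, hby'])
  · exact key (Function.update (Function.update a x true) y true)
      (by simp [h0]) (by simp [hxy, h1])
      (fun i hiy hix => by simp [hiy, hix, h2]) (by simp [dualHornRel, h0, h1, h2, hyx])
  · exact key (Function.update (Function.update (a ⊔ b) x true) y true)
      (by simp [h0]) (by simp [hxy, h1])
      (fun i hiy hix => by simp [hiy, hix, h2]) (by simp [dualHornRel, h0, h1, h2, hbyx])

theorem update_true_sup {α : Type} [DecidableEq α] (a b : α → Bool) (i : α) :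
    Function.update a i true ⊔ b = Function.update (a ⊔ b) i true := by
  funext j
  by_cases hj : j = i
  · subst hj; simp
  · simp [hj]

/-- Lemma 7: for `R` NAND-free and dual-Horn-free, if `F₁ · x⁺ · y⁺` and `F₂ · y⁺` are
both valid positive flip sequences at `s ∈ R` with `x⁺ ∉ C(F₂)`, then `F₁ · y⁺ · x⁺` is
also valid at `s`. -/
theorem swap_last_two_pos {k : ℕ} (R : Set (Fin k → Bool))
    (hnand : NANDFree R) (hdh : DualHornFree R)
    (s : Fin k → Bool) (hs : s ∈ R) (x y : Fin k)
    (F1 F2 : List (Flip (Fin k)))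
    (hpos1 : ∀ f ∈ F1, f.2 = true) (hpos2 : ∀ f ∈ F2, f.2 = true)
    (h1 : ValidSeq R s (F1 ++ [(x, true), (y, true)]))
    (h2 : ValidSeq R s (F2 ++ [(y, true)]))
    (hxF2 : (x, true) ∉ F2) :
    ValidSeq R s (F1 ++ [(y, true), (x, true)]) := by
  obtain ⟨hv1, ha, hax, hxR, hay', hyxR⟩ := validSeq_append.1 h1
  obtain ⟨hv2, hb, hby, hybR⟩ := validSeq_append.1 h2
  have hle1 := le_applySeq hpos1 s
  have hle2 := le_applySeq hpos2 s
  have hpos1x : ∀ f ∈ F1 ++ [(x, true)], f.2 = true := by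
    intro f hf
    rcases List.mem_append.1 hf with h | h
    · exact hpos1 f h
    · rw [List.mem_singleton.1 h]
  have hpos1xy : ∀ f ∈ F1 ++ [(x, true), (y, true)], f.2 = true := by
    intro f hf
    rcases List.mem_append.1 hf with h | h
    · exact hpos1 f h
    · rcases List.mem_pair.1 h with rfl | rfl <;> rfl
  have hv1x : ValidSeq R s (F1 ++ [(x, true)]) := validSeq_append.2 ⟨hv1, ha, hax, hxR⟩
  have hax1 : applySeq s F1 x = false := hax
  have hby1 : applySeq s F2 y = false := hby
  have hxy : x ≠ y := by
    rintro rfl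
    simp [applyFlip] at hay'
  have hay : applySeq s F1 y = false := by
    simpa [applyFlip, hxy.symm] using hay'
  have hsx : s x = false := by
    have := hle1 x
    rw [hax1] at this
    exact le_bot_iff.1 this
  have hbx : applySeq s F2 x = false := by
    rw [applySeq_apply_of_notMem ?_ s, hsx]
    rintro ⟨i, v⟩ hf rfl
    have hv : v = true := hpos2 _ hf
    exact hxF2 (hv ▸ hf)
  have hab := hnand.applySeq_sup_mem hpos1 hv1 hb hle2
  have habx := hnand.applySeq_sup_mem hpos1x hv1x hb hle2
  have habxy := hnand.applySeq_sup_mem hpos1xy h1 hb hle2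
  have hleb : s ≤ applyFlip (applySeq s F2) (y, true) :=
    hle2.trans (le_applySeq (F := [(y, true)]) (by simp) _)
  have haby := hnand.applySeq_sup_mem hpos1 hv1 hybR hleb
  simp only [applySeq, List.foldl_append, List.foldl_cons, List.foldl_nil, applyFlip,
    update_true_sup] at habx habxy
  rw [applyFlip, sup_comm, update_true_sup, sup_comm] at haby
  have hyR := hdh.update_mem hxy hax1 hay hbx hby1 ha hxR hyxR hab habx haby habxy
  refine validSeq_append.2 ⟨hv1, ha, by simpa using hay, hyR, ?_, ?_⟩
  · simpa [applyFlip, hxy] using hax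
  · change Function.update (Function.update _ y true) x true ∈ R
    rw [Function.update_comm hxy.symm]
    exact hyxR
end

section
/- Let R be a NAND-free and dual-Horn-free k-ary Boolean relation. If C_1 and C_2 are two positive flip sets that are valid at s ∈ R, then C_1 ∩ C_2 is also a valid flip set at s. -/
/-- A set of flips is a *valid flip set* at `s` if its elements can be arranged into a
flip sequence valid at `s`. -/
def ValidFlipSet {α : Type} [DecidableEq α] (R : Set (α → Bool)) (s : α → Bool)
    (C : Finset (Flip α)) : Prop :=
  ∃ F : List (Flip α), F.Nodup ∧ F.toFinset = C ∧ ValidSeq R s F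

/-- A relation on `k'` variables can only be read off from `k` coordinates if every variable
is used; this yields the arity bound. -/
theorem arity_le_of_forall_exists_inl {k k' : ℕ} {X : Fin k → Fin k' ⊕ Bool}
    (h : ∀ j, ∃ i, X i = Sum.inl j) : k' ≤ k := by
  choose g hg using h
  have hinj : Function.Injective g := fun a b hab =>
    Sum.inl_injective ((hg a).symm.trans (hab ▸ hg b))
  simpa using Fintype.card_le_of_injective g hinj

theorem NANDFree.sup_mem_s9 {k : ℕ} {R : Set (Fin k → Bool)} (hR : NANDFree R)
    {x y : Fin k → Bool} (hx : x ∈ R) (hy : y ∈ R) (hxy : x ⊓ y ∈ R) : x ⊔ y ∈ R := by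
  by_contra hsup
  let X : Fin k → Fin 2 ⊕ Bool := fun i =>
    if x i then (if y i then Sum.inr true else Sum.inl 0)
    else (if y i then Sum.inl 1 else Sum.inr false)
  have hX : ∀ r : Fin 2 → Bool, (fun i => Sum.elim r id (X i)) =
      fun i => (x i && y i) || (r 0 && x i) || (r 1 && y i) := by
    intro r
    funext i
    cases hxi : x i <;> cases hyi : y i <;> simp [X, hxi, hyi]
  refine hR ⟨arity_le_of_forall_exists_inl (X := X) fun j => ?_, X, fun r => ?_⟩
  · by_contra! hj
    fin_cases j
    · suffices h : x ⊔ y = y from hsup (by rwa [h])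
      funext i
      have := hj i
      cases hxi : x i <;> cases hyi : y i <;> simp_all [X]
    · suffices h : x ⊔ y = x from hsup (by rwa [h])
      funext i
      have := hj i
      cases hxi : x i <;> cases hyi : y i <;> simp_all [X]
  · have hz : (fun i => (x i && y i) || (r 0 && x i) || (r 1 && y i)) =
        if r 0 then (if r 1 then x ⊔ y else x) else (if r 1 then y else x ⊓ y) := by
      funext i
      cases r 0 <;> cases r 1 <;> cases hxi : x i <;> cases hyi : y i <;> simp [hxi, hyi]
    rw [hX, hz]
    cases h0 : r 0 <;> cases h1 : r 1 <;> simp_all [nandRel]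

theorem DualHornFree.update_inf_mem {k : ℕ} {R : Set (Fin k → Bool)} (hR : DualHornFree R)
    {x y : Fin k → Bool} {e : Fin k} (hxe : x e = false) (hye : y e = false)
    (hx : x ∈ R) (hy : y ∈ R) (hinf : x ⊓ y ∈ R) (hsup : x ⊔ y ∈ R)
    (hx' : Function.update x e true ∈ R) (hy' : Function.update y e true ∈ R)
    (hsup' : Function.update (x ⊔ y) e true ∈ R) :
    Function.update (x ⊓ y) e true ∈ R := by
  by_contra hn
  let X : Fin k → Fin 3 ⊕ Bool := fun i =>
    if i = e then Sum.inl 0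
    else if x i then (if y i then Sum.inr true else Sum.inl 1)
    else (if y i then Sum.inl 2 else Sum.inr false)
  have hX : ∀ r : Fin 3 → Bool, (fun i => Sum.elim r id (X i)) =
      fun i => if i = e then r 0 else (x i && y i) || (r 1 && x i) || (r 2 && y i) := by
    intro r
    funext i
    by_cases hi : i = e
    · simp [X, hi]
    · cases hxi : x i <;> cases hyi : y i <;> simp [X, hi, hxi, hyi]
  refine hR ⟨arity_le_of_forall_exists_inl (X := X) fun j => ?_, X, fun r => ?_⟩
  · by_contra! hj
    fin_cases j
    · exact hj e (by simp [X])
    · suffices h : x ⊓ y = x from hn (by rwa [h])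
      funext i
      have := hj i
      by_cases hi : i = e
      · simp [hi, hxe]
      · cases hxi : x i <;> cases hyi : y i <;> simp_all [X]
    · suffices h : x ⊓ y = y from hn (by rwa [h])
      funext i
      have := hj i
      by_cases hi : i = e
      · simp [hi, hye]
      · cases hxi : x i <;> cases hyi : y i <;> simp_all [X]
  · have hz : (fun i => if i = e then r 0
          else (x i && y i) || (r 1 && x i) || (r 2 && y i)) =
        let z := if r 1 then (if r 2 then x ⊔ y else x) else (if r 2 then y else x ⊓ y)
        if r 0 then Function.update z e true else z := by
      funext i
      by_cases hi : i = e
      · subst hi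
        cases r 0 <;> cases r 1 <;> cases r 2 <;> simp [hxe, hye]
      · cases r 0 <;> cases r 1 <;> cases r 2 <;> cases hxi : x i <;> cases hyi : y i <;>
          simp [hi, hxi, hyi]
    rw [hX, hz]
    cases h0 : r 0 <;> cases h1 : r 1 <;> cases h2 : r 2 <;> simp_all [dualHornRel]

/-- `y ∈ R` arises from `x` by one positive flip. -/
def UpStep {k : ℕ} (R : Set (Fin k → Bool)) (x y : Fin k → Bool) : Prop :=
  y ∈ R ∧ ∃ i, x i = false ∧ y = Function.update x i true

theorem mem_of_reflTransGen_upStep {k : ℕ} {R : Set (Fin k → Bool)} {s x : Fin k → Bool}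
    (hs : s ∈ R) (h : Relation.ReflTransGen (UpStep R) s x) : x ∈ R := by
  cases h with
  | refl => exact hs
  | tail _ h => exact h.1

theorem le_of_reflTransGen_upStep {k : ℕ} {R : Set (Fin k → Bool)} {s x : Fin k → Bool}
    (h : Relation.ReflTransGen (UpStep R) s x) : s ≤ x := by
  induction h with
  | refl => exact le_rfl
  | @tail b c _ h ih =>
    obtain ⟨-, i, hi, rfl⟩ := h
    exact ih.trans (le_update_self_iff.2 (Bool.le_true _))

theorem update_true_inf {k : ℕ} {x y : Fin k → Bool} {i : Fin k} (hy : y i = true) :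
    Function.update x i true ⊓ y = Function.update (x ⊓ y) i true := by
  funext j
  by_cases hj : j = i
  · subst hj; simp [hy]
  · simp [hj]

theorem update_true_inf_of_eq_false {k : ℕ} {x y : Fin k → Bool} {i : Fin k}
    (hy : y i = false) : Function.update x i true ⊓ y = x ⊓ y := by
  funext j
  by_cases hj : j = i
  · subst hj; simp [hy]
  · simp [hj]

theorem inf_mem_of_reflTransGen_upStep {k : ℕ} {R : Set (Fin k → Bool)}
    (hnand : NANDFree R) (hdh : DualHornFree R) {s x y : Fin k → Bool} (hs : s ∈ R)
    (hx : Relation.ReflTransGen (UpStep R) s x) (hy : Relation.ReflTransGen (UpStep R) s y) :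
    x ⊓ y ∈ R := by
  induction hx generalizing y with
  | refl => rwa [inf_eq_left.2 (le_of_reflTransGen_upStep hy)]
  | @tail x x' hx hxx' ihx =>
    induction hy with
    | refl => rwa [inf_eq_right.2 (le_of_reflTransGen_upStep (hx.tail hxx'))]
    | @tail y y' hy hyy' ihy =>
      have hxR := mem_of_reflTransGen_upStep hs hx
      have hyR := mem_of_reflTransGen_upStep hs hy
      have hxy := ihx hy
      have hxy' := ihx (hy.tail hyy')
      obtain ⟨hx'R, i, hi, rfl⟩ := hxx'
      obtain ⟨hy'R, j, hj, rfl⟩ := hyy'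
      by_cases hij : i = j
      · subst hij
        have hsup := hnand.sup_mem_s9 hxR hyR hxy
        have h := hdh.update_inf_mem hi hj hxR hyR hxy hsup hx'R hy'R ?_
        · convert h using 1
          funext l
          by_cases hl : l = i
          · subst hl; simp
          · simp [hl]
        · have h := hnand.sup_mem_s9 hx'R hsup ?_
          · convert h using 1
            funext l
            by_cases hl : l = i
            · subst hl; simp
            · simp [hl]
          · convert hxR using 1
            rw [update_true_inf_of_eq_false (by simp [hi, hj])]
            exact inf_sup_self
      · cases hyi : y i with
        | false =>
          rwa [update_true_inf_of_eq_false (by simp [hij, hyi])]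
        | true =>
          cases hxj : x j with
          | false =>
            rw [inf_comm, update_true_inf_of_eq_false (by simp [Ne.symm hij, hxj]), inf_comm]
            exact ihy
          | true =>
            have h := hnand.sup_mem_s9 ihy hxy' ?_
            · convert h using 1
              funext l
              by_cases hl : l = i
              · subst hl; simp [hij, hyi]
              · by_cases hl' : l = j
                · subst hl'; simp [hl, hxj]
                · simp [hl, hl']
            · convert hxy using 1
              funext l
              by_cases hl : l = i
              · subst hl; simp [hij, hi]
              · by_cases hl' : l = j
                · subst hl'; simp [hl, hj]
                · simp [hl, hl']

theorem ValidSeq.reflTransGen_upStep {k : ℕ} {R : Set (Fin k → Bool)} {s : Fin k → Bool}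
    {F : List (Flip (Fin k))} (h : ValidSeq R s F) (hpos : ∀ f ∈ F, f.2 = true) :
    Relation.ReflTransGen (UpStep R) s (applySeq s F) := by
  induction F generalizing s with
  | nil => exact .refl
  | cons f F ih =>
    obtain ⟨-, hf, hF⟩ := h
    have hmem : applyFlip s f ∈ R := by
      cases F with
      | nil => exact hF
      | cons => exact hF.1
    have hf2 : f.2 = true := hpos f (by simp)
    refine .head ⟨hmem, f.1, by simpa [hf2] using hf, by simp [applyFlip, hf2]⟩ ?_
    exact ih hF fun g hg => hpos g (by simp [hg])

theorem applySeq_eq_true_iff {k : ℕ} {s : Fin k → Bool} {F : List (Flip (Fin k))}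
    (hpos : ∀ f ∈ F, f.2 = true) (i : Fin k) :
    applySeq s F i = true ↔ s i = true ∨ (i, true) ∈ F := by
  induction F generalizing s with
  | nil => simp [applySeq]
  | cons f F ih =>
    obtain ⟨j, b⟩ := f
    obtain rfl : b = true := hpos _ (List.mem_cons_self ..)
    have h := ih (s := applyFlip s (j, true)) fun g hg => hpos g (by simp [hg])
    change applySeq (applyFlip s (j, true)) F i = true ↔ _
    rw [h]
    by_cases hij : i = j
    · subst hij; simp [applyFlip]
    · simp [applyFlip, hij]

theorem ValidSeq.eq_false_of_mem {k : ℕ} {R : Set (Fin k → Bool)} {s : Fin k → Bool}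
    {F : List (Flip (Fin k))} (h : ValidSeq R s F) (hpos : ∀ f ∈ F, f.2 = true)
    {f : Flip (Fin k)} (hf : f ∈ F) : s f.1 = false := by
  induction F generalizing s with
  | nil => simp at hf
  | cons g F ih =>
    obtain ⟨-, hg, hF⟩ := h
    have hg2 : g.2 = true := hpos g (by simp)
    have hsg : s g.1 = false := by simpa [hg2] using hg
    rcases List.mem_cons.1 hf with rfl | hf
    · exact hsg
    · have h := ih hF (fun g hg => hpos g (by simp [hg])) hf
      by_cases hfg : f.1 = g.1
      · rwa [hfg]
      · simpa [applyFlip, hfg] using h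

theorem ValidSeq.filter_inf {k : ℕ} {R : Set (Fin k → Bool)} {s y : Fin k → Bool}
    {F : List (Flip (Fin k))} (h : ValidSeq R s F) (hpos : ∀ f ∈ F, f.2 = true)
    (hy : ∀ x, Relation.ReflTransGen (UpStep R) s x → x ⊓ y ∈ R) :
    ValidSeq R (s ⊓ y) (F.filter fun f => y f.1) := by
  induction F generalizing s with
  | nil => exact hy s .refl
  | cons f F ih =>
    have hf2 : f.2 = true := hpos f (by simp)
    have hsf := h.eq_false_of_mem hpos (List.mem_cons_self ..)
    have hstep : UpStep R s (applyFlip s f) := by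
      refine ⟨?_, f.1, hsf, by simp [applyFlip, hf2]⟩
      cases F with
      | nil => exact h.2.2
      | cons => exact h.2.2.1
    have hrec := ih h.2.2 (fun g hg => hpos g (by simp [hg]))
      fun x hx => hy x (.head hstep hx)
    cases hyf : y f.1 with
    | false =>
      rw [List.filter_cons_of_neg (by simp [hyf])]
      rwa [applyFlip, hf2, update_true_inf_of_eq_false hyf] at hrec
    | true =>
      rw [List.filter_cons_of_pos (by simp [hyf])]
      refine ⟨hy s .refl, by simp [hsf, hf2], ?_⟩
      rw [applyFlip, hf2, update_true_inf hyf] at hrec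
      rwa [applyFlip, hf2]

/-- Lemma 8: for `R` NAND-free and dual-Horn-free, the intersection of two positive flip
sets valid at `s ∈ R` is a valid flip set at `s`. -/
theorem inter_validFlipSet {k : ℕ} (R : Set (Fin k → Bool))
    (hnand : NANDFree R) (hdh : DualHornFree R)
    (s : Fin k → Bool) (hs : s ∈ R) (C1 C2 : Finset (Flip (Fin k)))
    (hpos1 : ∀ f ∈ C1, f.2 = true) (hpos2 : ∀ f ∈ C2, f.2 = true)
    (h1 : ValidFlipSet R s C1) (h2 : ValidFlipSet R s C2) :
    ValidFlipSet R s (C1 ∩ C2) := by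
  obtain ⟨F1, hnd, rfl, hv1⟩ := h1
  obtain ⟨F2, -, rfl, hv2⟩ := h2
  simp only [List.mem_toFinset] at hpos1 hpos2
  have hreach := hv2.reflTransGen_upStep hpos2
  have h := hv1.filter_inf (y := applySeq s F2) hpos1 fun x hx =>
    inf_mem_of_reflTransGen_upStep hnand hdh hs hx hreach
  rw [inf_eq_left.2 (le_of_reflTransGen_upStep hreach)] at h
  refine ⟨_, hnd.filter _, ?_, h⟩
  ext ⟨i, b⟩
  simp only [List.mem_toFinset, List.mem_filter, Finset.mem_inter]
  refine and_congr_right fun hf => ?_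
  obtain rfl : b = true := hpos1 _ hf
  have hsi : s i = false := hv1.eq_false_of_mem hpos1 hf
  simp [applySeq_eq_true_iff hpos2, hsi]
end

section
/- Let R be a NAND-free and dual-Horn-free k-ary Boolean relation and s ∈ R. The family of positive flip sets that are valid at s, ordered by set inclusion, is closed under union and intersection, and hence forms a distributive lattice with join given by union and meet given by intersection. -/
/-- The assignment obtained from `s` by setting all variables in `C` to `true`. -/
def raise {α : Type} [DecidableEq α] (s : α → Bool) (C : Finset α) : α → Bool :=
  fun i => s i || decide (i ∈ C)

/-- `RaiseReachable R s C`: the variables in `C` are `false` in `s` and can be set to `true`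
one at a time without leaving `R`. -/
inductive RaiseReachable {α : Type} [DecidableEq α] (R : Set (α → Bool)) (s : α → Bool) :
    Finset α → Prop
  | empty : s ∈ R → RaiseReachable R s ∅
  | insert {C : Finset α} {x : α} : RaiseReachable R s C → s x = false →
      raise s (Insert.insert x C) ∈ R → RaiseReachable R s (Insert.insert x C)

section Raise

variable {α : Type} [DecidableEq α] {R : Set (α → Bool)} {s : α → Bool}

lemma raise_empty (s : α → Bool) : raise s ∅ = s := by
  ext i; simp [raise]

lemma applyFlip_raise (s : α → Bool) (C : Finset α) (x : α) :
    applyFlip (raise s C) (x, true) = raise s (insert x C) := by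
  ext i
  by_cases h : i = x
  · subst h; simp [applyFlip, raise]
  · simp [applyFlip, raise, h]

lemma RaiseReachable.raise_mem {C : Finset α} (h : RaiseReachable R s C) : raise s C ∈ R := by
  cases h with
  | empty hs => rwa [raise_empty]
  | insert _ _ h => exact h

lemma ValidSeq.mem {F : List (Flip α)} (h : ValidSeq R s F) : s ∈ R := by
  cases F with
  | nil => exact h
  | cons f F => exact h.1

lemma ValidSeq.append_singleton {F : List (Flip α)} {f : Flip α} (h : ValidSeq R s F)
    (hf : applySeq s F f.1 = !f.2) (hR : applyFlip (applySeq s F) f ∈ R) :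
    ValidSeq R s (F ++ [f]) := by
  induction F generalizing s with
  | nil => exact ⟨h, hf, hR⟩
  | cons g F ih => exact ⟨h.1, h.2.1, ih h.2.2 hf hR⟩

lemma applySeq_eq_raise {F : List (Flip α)} (hF : ∀ f ∈ F, f.2 = true) (s : α → Bool) :
    applySeq s F = raise s (F.toFinset.image Prod.fst) := by
  induction F using List.reverseRecOn with
  | nil => simp [applySeq, raise_empty]
  | append_singleton F f ih =>
    obtain ⟨x, b⟩ := f
    obtain rfl : b = true := hF (x, b) (by simp)
    have ih := ih fun f hf => hF f (by simp [hf])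
    have h : applySeq s (F ++ [(x, true)]) = applyFlip (applySeq s F) (x, true) := by
      simp [applySeq]
    rw [h, ih, applyFlip_raise]
    congr 1
    ext i
    simp

lemma RaiseReachable.validFlipSet {D : Finset α} (h : RaiseReachable R s D) :
    ValidFlipSet R s (D.image fun x => (x, true)) := by
  induction h with
  | empty hs => exact ⟨[], by simp, by simp, hs⟩
  | @insert C x _ hx hR ih =>
    by_cases hxC : x ∈ C
    · rwa [Finset.insert_eq_of_mem hxC]
    obtain ⟨F, hnd, hF, hv⟩ := ih
    have hpos : ∀ f ∈ F, f.2 = true := fun f hf => by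
      rw [← List.mem_toFinset, hF] at hf
      obtain ⟨y, -, rfl⟩ := Finset.mem_image.1 hf
      rfl
    have hmem : (x, true) ∉ F := by
      rw [← List.mem_toFinset, hF]
      simpa using hxC
    have hseq : applySeq s F = raise s C := by
      rw [applySeq_eq_raise hpos, hF, Finset.image_image]
      congr 1
      ext i
      simp
    refine ⟨F ++ [(x, true)], ?_, ?_, hv.append_singleton ?_ ?_⟩
    · rw [List.nodup_append]
      refine ⟨hnd, by simp, ?_⟩
      rintro a ha b hb rfl
      exact hmem (by simpa using (List.mem_singleton.1 hb) ▸ ha)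
    · rw [List.toFinset_append, hF, Finset.image_insert]
      ext i
      simp
    · simp [hseq, raise, hx, hxC]
    · rwa [hseq, applyFlip_raise]

lemma ValidSeq.raiseReachable {C : Finset α} {F : List (Flip α)}
    (hpos : ∀ f ∈ F, f.2 = true) (hC : RaiseReachable R s C)
    (hF : ValidSeq R (raise s C) F) :
    RaiseReachable R s (C ∪ F.toFinset.image Prod.fst) := by
  induction F generalizing C with
  | nil => simpa using hC
  | cons f F ih =>
    obtain ⟨x, b⟩ := f
    obtain rfl : b = true := hpos (x, b) (by simp)
    obtain ⟨-, hx, hF⟩ := hF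
    rw [applyFlip_raise] at hF
    have hx : s x = false := by
      have : s x = false ∧ x ∉ C := by simpa [raise] using hx
      exact this.1
    have := ih (fun f hf => hpos f (by simp [hf])) (hC.insert hx hF.mem) hF
    simpa [Finset.image_insert] using this

lemma validFlipSet_iff_raiseReachable {C : Finset (Flip α)} (hC : ∀ f ∈ C, f.2 = true) :
    ValidFlipSet R s C ↔ RaiseReachable R s (C.image Prod.fst) := by
  constructor
  · rintro ⟨F, -, rfl, hF⟩
    have := ValidSeq.raiseReachable (C := ∅) (fun f hf => hC f (by simpa using hf))
      (.empty hF.mem) (by rwa [raise_empty])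
    simpa using this
  · intro h
    have := h.validFlipSet
    rw [Finset.image_image] at this
    convert this
    symm
    convert Finset.image_id using 1
    refine Finset.image_congr fun f hf => ?_
    exact Prod.ext rfl (hC f hf).symm

end Raise

section Restrictions

variable {k : ℕ} {R : Set (Fin k → Bool)} {s : Fin k → Bool}

lemma NANDFree.raise_insert_insert_mem (hR : NANDFree R) {C : Finset (Fin k)} {x y : Fin k}
    (hC : raise s C ∈ R) (hxC : raise s (insert x C) ∈ R) (hyC : raise s (insert y C) ∈ R)
    (hx : s x = false) (hy : s y = false) : raise s (insert x (insert y C)) ∈ R := by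
  by_cases hxy : x = y
  · simpa [hxy] using hyC
  by_cases hxm : x ∈ C
  · rwa [Finset.insert_eq_of_mem (by simp [hxm])]
  by_cases hym : y ∈ C
  · rwa [Finset.insert_eq_of_mem hym]
  by_contra hn
  refine hR ⟨?_, fun i => if i = x then .inl 0 else if i = y then .inl 1 else .inr (raise s C i),
    fun r => ?_⟩
  · simpa [Finset.card_pair hxy] using Finset.card_le_univ {x, y}
  have key : (fun i => Sum.elim r id (if i = x then .inl 0 else if i = y then .inl 1 else
      .inr (raise s C i))) =
      raise s ((if r 0 then {x} else ∅) ∪ (if r 1 then {y} else ∅) ∪ C) := by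
    funext i
    by_cases hix : i = x
    · subst hix
      cases h0 : r 0 <;> cases h1 : r 1 <;> simp [raise, *]
    by_cases hiy : i = y
    · subst hiy
      cases h0 : r 0 <;> cases h1 : r 1 <;> simp [raise, *]
    cases h0 : r 0 <;> cases h1 : r 1 <;> simp [raise, *]
  rw [key]
  cases h0 : r 0 <;> cases h1 : r 1 <;> simp [nandRel, *]

lemma RaiseReachable.union (hR : NANDFree R) {C D : Finset (Fin k)}
    (hC : RaiseReachable R s C) (hD : RaiseReachable R s D) : RaiseReachable R s (C ∪ D) := by
  induction hD generalizing C with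
  | empty => simpa using hC
  | @insert D y hD hy hyD ihD =>
    induction hC with
    | empty => simpa using hD.insert hy hyD
    | @insert C x hC hx hxC ihC =>
      have hmem := hR.raise_insert_insert_mem (x := x) (y := y) (ihD hC).raise_mem
        (by simpa using (ihD (hC.insert hx hxC)).raise_mem)
        (by simpa using ihC.raise_mem) hx hy
      rw [Finset.union_insert] at ihC
      simpa [Finset.insert_comm] using ihC.insert hx hmem

lemma DualHornFree.raise_insert_inter_mem (hR : DualHornFree R) {Y Z : Finset (Fin k)}
    {x : Fin k} (hx : s x = false) (hxY : x ∉ Y) (hxZ : x ∉ Z) (hYs : ∀ y ∈ Y, s y = false)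
    (hZs : ∀ z ∈ Z, s z = false) (hYZ : raise s (Y ∩ Z) ∈ R) (hY : raise s Y ∈ R)
    (hZ : raise s Z ∈ R) (hU : raise s (Y ∪ Z) ∈ R) (hY' : raise s (insert x Y) ∈ R)
    (hZ' : raise s (insert x Z) ∈ R) (hU' : raise s (insert x (Y ∪ Z)) ∈ R) :
    raise s (insert x (Y ∩ Z)) ∈ R := by
  by_contra hn
  obtain ⟨y, hyY, hyZ⟩ : ∃ y ∈ Y, y ∉ Z := by
    by_contra! h
    exact hn (by rwa [Finset.inter_eq_left.2 h])
  obtain ⟨z, hzZ, hzY⟩ : ∃ z ∈ Z, z ∉ Y := by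
    by_contra! h
    exact hn (by rwa [Finset.inter_eq_right.2 h])
  have hxy : x ≠ y := by rintro rfl; exact hxY hyY
  have hxz : x ≠ z := by rintro rfl; exact hxZ hzZ
  have hyz : y ≠ z := by rintro rfl; exact hyZ hzZ
  refine hR ⟨?_, fun i => if i = x then .inl 0 else if i ∈ Y ∧ i ∉ Z then .inl 1 else
    if i ∈ Z ∧ i ∉ Y then .inl 2 else .inr (raise s (Y ∩ Z) i), fun r => ?_⟩
  · simpa [Finset.card_eq_three.2 ⟨x, y, z, hxy, hxz, hyz, rfl⟩] using
      Finset.card_le_univ {x, y, z}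
  have key : (fun i => Sum.elim r id (if i = x then .inl 0 else if i ∈ Y ∧ i ∉ Z then .inl 1 else
      if i ∈ Z ∧ i ∉ Y then .inl 2 else .inr (raise s (Y ∩ Z) i))) =
      raise s ((if r 0 then {x} else ∅) ∪ (if r 1 then Y else ∅) ∪ (if r 2 then Z else ∅) ∪
        Y ∩ Z) := by
    funext i
    by_cases hix : i = x
    · subst hix
      cases h0 : r 0 <;> cases h1 : r 1 <;> cases h2 : r 2 <;> simp [raise, *]
    by_cases hiY : i ∈ Y <;> by_cases hiZ : i ∈ Z <;> cases h0 : r 0 <;> cases h1 : r 1 <;>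
      cases h2 : r 2 <;> simp [raise, *]
  have e1 : Z ∪ Y ∩ Z = Z := Finset.union_eq_left.2 Finset.inter_subset_right
  have e2 : Y ∪ Y ∩ Z = Y := Finset.union_eq_left.2 Finset.inter_subset_left
  rw [key]
  cases h0 : r 0 <;> cases h1 : r 1 <;> cases h2 : r 2 <;>
    simp [dualHornRel, *]

lemma RaiseReachable.eq_false {C : Finset (Fin k)} (h : RaiseReachable R s C) :
    ∀ x ∈ C, s x = false := by
  induction h with
  | empty => simp
  | insert _ hx _ ih => simpa [hx] using ih

lemma RaiseReachable.inter (hN : NANDFree R) (hD : DualHornFree R) {C₁ C₂ : Finset (Fin k)}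
    (h₁ : RaiseReachable R s C₁) (h₂ : RaiseReachable R s C₂) :
    RaiseReachable R s (C₁ ∩ C₂) := by
  induction h₁ generalizing C₂ with
  | empty hs => simpa using RaiseReachable.empty hs
  | @insert Y x hY hx hxY ih₁ =>
    induction h₂ with
    | empty hs => simpa using RaiseReachable.empty hs
    | @insert Z z hZ hz hzZ ih₂ =>
      have hYx := hY.insert hx hxY
      have hZz := hZ.insert hz hzZ
      have hYZ := ih₁ hZz
      by_cases hxm : x ∈ Y
      · rwa [Finset.insert_eq_of_mem hxm]
      by_cases hzm : z ∈ Z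
      · rwa [Finset.insert_eq_of_mem hzm]
      by_cases hxz : x = z
      · subst hxz
        have hU := (hY.union hN hZ).raise_mem
        have hU' := (hYx.union hN hZ).raise_mem
        rw [Finset.insert_union] at hU'
        rw [← Finset.insert_inter_distrib]
        exact (ih₁ hZ).insert hx (hD.raise_insert_inter_mem hx hxm hzm hY.eq_false hZ.eq_false
          (ih₁ hZ).raise_mem hY.raise_mem hZ.raise_mem hU hxY hzZ hU')
      · convert ih₂.union hN hYZ using 1
        ext i
        simp only [Finset.mem_inter, Finset.mem_union, Finset.mem_insert]
        by_cases hix : i = x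
        · subst hix; simp [hxz]
        · simp [hix]; tauto

lemma ValidFlipSet.union_inter (hN : NANDFree R) (hD : DualHornFree R)
    {C₁ C₂ : Finset (Flip (Fin k))} (hp₁ : ∀ f ∈ C₁, f.2 = true) (hp₂ : ∀ f ∈ C₂, f.2 = true)
    (h₁ : ValidFlipSet R s C₁) (h₂ : ValidFlipSet R s C₂) :
    ValidFlipSet R s (C₁ ∪ C₂) ∧ ValidFlipSet R s (C₁ ∩ C₂) := by
  rw [validFlipSet_iff_raiseReachable hp₁] at h₁
  rw [validFlipSet_iff_raiseReachable hp₂] at h₂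
  rw [validFlipSet_iff_raiseReachable fun f hf => (Finset.mem_union.1 hf).elim (hp₁ f) (hp₂ f),
    validFlipSet_iff_raiseReachable fun f hf => hp₁ f (Finset.mem_inter.1 hf).1,
    Finset.image_union, Finset.image_inter_of_injOn]
  · exact ⟨h₁.union hN h₂, h₁.inter hN hD h₂⟩
  · have hp : ∀ f ∈ (C₁ ∪ C₂ : Set (Flip (Fin k))), f.2 = true :=
      fun f hf => hf.elim (hp₁ f) (hp₂ f)
    exact fun f hf g hg hfg => Prod.ext hfg ((hp f hf).trans (hp g hg).symm)

end Restrictions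

/-- The family of positive flip sets valid at `s` for a NAND-free and dual-Horn-free
relation `R`, ordered by inclusion, is closed under union and intersection and forms a
distributive lattice in which join is union and meet is intersection. -/
theorem validFlipSets_distribLattice {k : ℕ} (R : Set (Fin k → Bool))
    (hnand : NANDFree R) (hdh : DualHornFree R)
    (s : Fin k → Bool) (hs : s ∈ R) :
    (∀ C1 C2 : Finset (Flip (Fin k)),
      (∀ f ∈ C1, f.2 = true) → (∀ f ∈ C2, f.2 = true) →
      ValidFlipSet R s C1 → ValidFlipSet R s C2 →
      ValidFlipSet R s (C1 ∪ C2) ∧ ValidFlipSet R s (C1 ∩ C2)) ∧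
    ∃ inst : DistribLattice
        {C : Finset (Flip (Fin k)) // (∀ f ∈ C, f.2 = true) ∧ ValidFlipSet R s C},
      ∀ A B : {C : Finset (Flip (Fin k)) // (∀ f ∈ C, f.2 = true) ∧ ValidFlipSet R s C},
        (inst.le A B ↔ A.val ⊆ B.val) ∧
        (inst.sup A B).val = A.val ∪ B.val ∧
        (inst.inf A B).val = A.val ∩ B.val := by
  refine ⟨fun _ _ hp₁ hp₂ => ValidFlipSet.union_inter hnand hdh hp₁ hp₂, ?_⟩
  let L : Sublattice (Finset (Flip (Fin k))) :=
    { carrier := {C | (∀ f ∈ C, f.2 = true) ∧ ValidFlipSet R s C}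
      supClosed' := fun A hA B hB =>
        ⟨fun f hf => (Finset.mem_union.1 hf).elim (hA.1 f) (hB.1 f),
          (ValidFlipSet.union_inter hnand hdh hA.1 hB.1 hA.2 hB.2).1⟩
      infClosed' := fun A hA B hB =>
        ⟨fun f hf => hA.1 f (Finset.mem_inter.1 hf).1,
          (ValidFlipSet.union_inter hnand hdh hA.1 hB.1 hA.2 hB.2).2⟩ }
  exact ⟨(inferInstance : DistribLattice L), fun A B => ⟨Iff.rfl, rfl, rfl⟩⟩
end
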